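/- Let σ : G(p,q,r) → G(p,q,r) be the automorphism determined by σ(h) = h⁻¹, σ(x) = x⁻¹, σ(y) = x·y⁻¹·x⁻¹, σ(z) = x·y·z⁻¹·y⁻¹·x⁻¹. For every irreducible homomorphism α : G(p,q,r) → Sp(1) there exists ρ ∈ Sp(1) with ρ² = -1 such that α(σ(t)) = ρ·α(t)·ρ⁻¹ for all t ∈ G(p,q,r); any ρ' ∈ Sp(1) with this property satisfies ρ' = ρ or ρ' = -ρ. In particular, every irreducible α is conjugate to α∘σ, i.e. the induced involution on the set of conjugacy classes of irreducible representations is trivial. -/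

import Mathlib

open Quaternion

/-- `Sp(1)`: the multiplicative group of unit quaternions, identified with `SU(2)`. -/
noncomputable abbrev Sp1 : Type := Metric.sphere (0 : ℍ[ℝ]) 1

/-- Relators of the presentation
`⟨x, y, z, h | h central, x^p = h^{-b₁}, y^q = h^{-b₂}, z^r = h^{-b₃}, xyz = h^{-b}⟩`,
with the generators `x, y, z, h` encoded as `0, 1, 2, 3 : Fin 4`. -/
def brieskornRels (p q r : ℕ) (b b₁ b₂ b₃ : ℤ) : Set (FreeGroup (Fin 4)) :=
  { (FreeGroup.of 3) * (FreeGroup.of 0) * (FreeGroup.of 3)⁻¹ * (FreeGroup.of 0)⁻¹,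
    (FreeGroup.of 3) * (FreeGroup.of 1) * (FreeGroup.of 3)⁻¹ * (FreeGroup.of 1)⁻¹,
    (FreeGroup.of 3) * (FreeGroup.of 2) * (FreeGroup.of 3)⁻¹ * (FreeGroup.of 2)⁻¹,
    (FreeGroup.of 0) ^ p * (FreeGroup.of 3) ^ b₁,
    (FreeGroup.of 1) ^ q * (FreeGroup.of 3) ^ b₂,
    (FreeGroup.of 2) ^ r * (FreeGroup.of 3) ^ b₃,
    (FreeGroup.of 0) * (FreeGroup.of 1) * (FreeGroup.of 2) * (FreeGroup.of 3) ^ b }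

/-- The group `G(p,q,r)`, i.e. the fundamental group of the Brieskorn homology
sphere `Σ(p,q,r)`, given by the presentation above. -/
def BrieskornGroup (p q r : ℕ) (b b₁ b₂ b₃ : ℤ) : Type :=
  PresentedGroup (brieskornRels p q r b b₁ b₂ b₃)

instance (p q r : ℕ) (b b₁ b₂ b₃ : ℤ) : Group (BrieskornGroup p q r b b₁ b₂ b₃) := by
  unfold BrieskornGroup; infer_instance

/-- The generator `x` of `G(p,q,r)`. -/
def xG {p q r : ℕ} {b b₁ b₂ b₃ : ℤ} : BrieskornGroup p q r b b₁ b₂ b₃ := PresentedGroup.of 0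
/-- The generator `y` of `G(p,q,r)`. -/
def yG {p q r : ℕ} {b b₁ b₂ b₃ : ℤ} : BrieskornGroup p q r b b₁ b₂ b₃ := PresentedGroup.of 1
/-- The generator `z` of `G(p,q,r)`. -/
def zG {p q r : ℕ} {b b₁ b₂ b₃ : ℤ} : BrieskornGroup p q r b b₁ b₂ b₃ := PresentedGroup.of 2
/-- The central generator `h` of `G(p,q,r)`. -/
def hG {p q r : ℕ} {b b₁ b₂ b₃ : ℤ} : BrieskornGroup p q r b b₁ b₂ b₃ := PresentedGroup.of 3

/-- A homomorphism to `Sp(1)` is irreducible if its image is nonabelian. -/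
def IsIrrep {Γ : Type*} [Group Γ] (α : Γ →* Sp1) : Prop :=
  ∃ s t : Γ, α s * α t ≠ α t * α s

/-- The defining values of the involution `σ` on the generators of `G(p,q,r)`. -/
def SigmaSpec {p q r : ℕ} {b b₁ b₂ b₃ : ℤ}
    (σ : BrieskornGroup p q r b b₁ b₂ b₃ →* BrieskornGroup p q r b b₁ b₂ b₃) : Prop :=
  σ hG = hG⁻¹ ∧ σ xG = xG⁻¹ ∧ σ yG = xG * yG⁻¹ * xG⁻¹ ∧
    σ zG = xG * yG * zG⁻¹ * yG⁻¹ * xG⁻¹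

section QuaternionLemmas

variable {X Y u : ℍ[ℝ]}

/-- The commutator of two quaternions is purely imaginary. -/
theorem Quaternion.re_commutator (X Y : ℍ[ℝ]) : (X * Y - Y * X).re = 0 := by
  simp only [Quaternion.re_sub, Quaternion.re_mul]
  ring

/-- The commutator of `X` and `Y` intertwines `X` with its conjugate. -/
theorem Quaternion.commutator_mul_left (X Y : ℍ[ℝ]) :
    (X * Y - Y * X) * X = star X * (X * Y - Y * X) := by
  ext <;> simp <;> ring

/-- The commutator of `X` and `Y` intertwines `Y` with its conjugate. -/
theorem Quaternion.commutator_mul_right (X Y : ℍ[ℝ]) :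
    (X * Y - Y * X) * Y = star Y * (X * Y - Y * X) := by
  ext <;> simp <;> ring

/-- A quaternion commuting with two noncommuting quaternions is real. -/
theorem Quaternion.im_eq_zero_of_commute (hXY : X * Y ≠ Y * X) (hX : u * X = X * u)
    (hY : u * Y = Y * u) : u.imI = 0 ∧ u.imJ = 0 ∧ u.imK = 0 := by
  have x1 := congrArg QuaternionAlgebra.imI hX
  have x2 := congrArg QuaternionAlgebra.imJ hX
  have x3 := congrArg QuaternionAlgebra.imK hX
  have y1 := congrArg QuaternionAlgebra.imI hY
  have y2 := congrArg QuaternionAlgebra.imJ hY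
  have y3 := congrArg QuaternionAlgebra.imK hY
  simp only [Quaternion.imI_mul, Quaternion.imJ_mul, Quaternion.imK_mul] at x1 x2 x3 y1 y2 y3
  by_contra hu
  apply hXY
  ext <;> simp only [Quaternion.re_mul, Quaternion.imI_mul, Quaternion.imJ_mul, Quaternion.imK_mul]
  all_goals grind

end QuaternionLemmas

namespace Sp1

theorem coe_inv_eq_star (a : Sp1) : ((a⁻¹ : Sp1) : ℍ[ℝ]) = star (a : ℍ[ℝ]) := by
  have h : ‖(a : ℍ[ℝ])‖ = 1 := mem_sphere_zero_iff_norm.mp a.2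
  have hn : Quaternion.normSq (a : ℍ[ℝ]) = 1 := by
    rw [Quaternion.normSq_eq_norm_mul_self, h, one_mul]
  rw [Metric.unitSphere.coe_inv]
  change (Quaternion.normSq (a : ℍ[ℝ]))⁻¹ • star (a : ℍ[ℝ]) = _
  rw [hn, inv_one, one_smul]

theorem mul_neg_one (a : Sp1) : a * -1 = -a :=
  Subtype.ext (_root_.mul_neg_one (a : ℍ[ℝ]))

theorem neg_one_mul (a : Sp1) : -1 * a = -a :=
  Subtype.ext (_root_.neg_one_mul (a : ℍ[ℝ]))

theorem inv_neg_one : (-1 : Sp1)⁻¹ = -1 :=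
  inv_eq_of_mul_eq_one_right ((mul_neg_one (-1)).trans (Subtype.ext (neg_neg (1 : ℍ[ℝ]))))

/-- A unit quaternion commuting with two noncommuting unit quaternions is `1` or `-1`. -/
theorem eq_one_or_neg_one_of_commute {X Y u : Sp1} (hXY : X * Y ≠ Y * X)
    (hX : u * X = X * u) (hY : u * Y = Y * u) : u = 1 ∨ u = -1 := by
  obtain ⟨hi, hj, hk⟩ := Quaternion.im_eq_zero_of_commute (X := X) (Y := Y) (u := u)
    (fun h => hXY (Subtype.ext h)) (congrArg Subtype.val hX) (congrArg Subtype.val hY)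
  have hu : (u : ℍ[ℝ]) = ((u : ℍ[ℝ]).re : ℍ[ℝ]) := by
    ext <;> simp [hi, hj, hk]
  have hn : ‖(u : ℍ[ℝ])‖ = 1 := mem_sphere_zero_iff_norm.mp u.2
  rw [hu, Quaternion.norm_coe, Real.norm_eq_abs] at hn
  refine (eq_or_eq_neg_of_abs_eq hn).imp (fun h => Subtype.ext ?_) fun h => Subtype.ext ?_ <;>
  · rw [hu, h]
    simp

/-- Two noncommuting unit quaternions are inverted simultaneously by conjugation with some
unit quaternion of square `-1`. -/
theorem exists_conj_eq_inv {X Y : Sp1} (hXY : X * Y ≠ Y * X) :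
    ∃ w : Sp1, w ^ 2 = -1 ∧ w * X = X⁻¹ * w ∧ w * Y = Y⁻¹ * w := by
  set v : ℍ[ℝ] := (X : ℍ[ℝ]) * Y - Y * X with hv
  have hv0 : v ≠ 0 := fun h => hXY (Subtype.ext (sub_eq_zero.mp h))
  have hn : ‖v‖ ≠ 0 := norm_ne_zero_iff.mpr hv0
  have hsq : v * v = -((‖v‖ * ‖v‖ : ℝ) : ℍ[ℝ]) := by
    have hstar : star v = -v := by
      have := Quaternion.re_commutator (X : ℍ[ℝ]) Y
      rw [← hv] at this
      ext <;> simp [this]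
    rw [← Quaternion.normSq_eq_norm_mul_self, ← Quaternion.self_mul_star, hstar]
    simp
  refine ⟨⟨‖v‖⁻¹ • v, ?_⟩, Subtype.ext ?_, Subtype.ext ?_, Subtype.ext ?_⟩
  · rw [mem_sphere_zero_iff_norm, norm_smul, norm_inv, norm_norm, inv_mul_cancel₀ hn]
  · rw [Metric.unitSphere.coe_pow, sq, smul_mul_smul_comm, hsq, smul_neg, ← Quaternion.coe_smul,
      smul_eq_mul]
    have : ‖v‖⁻¹ * ‖v‖⁻¹ * (‖v‖ * ‖v‖) = 1 := by field_simp
    rw [this]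
    simp
  · simp only [Metric.unitSphere.coe_mul, coe_inv_eq_star, smul_mul_assoc, mul_smul_comm, hv,
      Quaternion.commutator_mul_left]
  · simp only [Metric.unitSphere.coe_mul, coe_inv_eq_star, smul_mul_assoc, mul_smul_comm, hv,
      Quaternion.commutator_mul_right]

end Sp1

namespace BrieskornGroup

variable {p q r : ℕ} {b b₁ b₂ b₃ : ℤ}

theorem rel_eq_one {w : FreeGroup (Fin 4)} (hw : w ∈ brieskornRels p q r b b₁ b₂ b₃) :
    (PresentedGroup.mk (brieskornRels p q r b b₁ b₂ b₃) w) = 1 :=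
  PresentedGroup.one_of_mem hw

theorem h_mul_x : (hG : BrieskornGroup p q r b b₁ b₂ b₃) * xG = xG * hG := by
  have h : (hG : BrieskornGroup p q r b b₁ b₂ b₃) * xG * hG⁻¹ * xG⁻¹ = 1 :=
    rel_eq_one (by simp [brieskornRels])
  simpa [mul_inv_eq_one, mul_inv_eq_iff_eq_mul] using h

theorem h_mul_y : (hG : BrieskornGroup p q r b b₁ b₂ b₃) * yG = yG * hG := by
  have h : (hG : BrieskornGroup p q r b b₁ b₂ b₃) * yG * hG⁻¹ * yG⁻¹ = 1 :=
    rel_eq_one (by simp [brieskornRels])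
  simpa [mul_inv_eq_one, mul_inv_eq_iff_eq_mul] using h

theorem z_eq : (zG : BrieskornGroup p q r b b₁ b₂ b₃) = (xG * yG)⁻¹ * (hG ^ b)⁻¹ := by
  have h : (xG : BrieskornGroup p q r b b₁ b₂ b₃) * yG * zG * hG ^ b = 1 :=
    rel_eq_one (by simp [brieskornRels])
  rw [mul_eq_one_iff_eq_inv] at h
  rw [← h]
  group

/-- Homomorphisms out of the group are determined by their values on `x`, `y` and `h`. -/
theorem hom_ext {M : Type*} [Group M] {f g : BrieskornGroup p q r b b₁ b₂ b₃ →* M}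
    (hx : f xG = g xG) (hy : f yG = g yG) (hh : f hG = g hG) : f = g := by
  have hz : f zG = g zG := by simp only [z_eq, map_mul, map_inv, map_zpow, hx, hy, hh]
  refine PresentedGroup.ext fun i => ?_
  fin_cases i
  exacts [hx, hy, hz, hh]

/-- An element commuting with the images of `x`, `y` and `h` commutes with the whole image. -/
theorem commute_of_commute {M : Type*} [Group M] (f : BrieskornGroup p q r b b₁ b₂ b₃ →* M)
    {c : M} (hx : c * f xG = f xG * c) (hy : c * f yG = f yG * c) (hh : c * f hG = f hG * c)
    (t : BrieskornGroup p q r b b₁ b₂ b₃) : c * f t = f t * c := by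
  have h : (MulAut.conj c).toMonoidHom.comp f = f :=
    hom_ext (by simp [hx]) (by simp [hy]) (by simp [hh])
  simpa [mul_inv_eq_iff_eq_mul] using DFunLike.congr_fun h t

theorem map_h_commute {M : Type*} [Group M] (f : BrieskornGroup p q r b b₁ b₂ b₃ →* M)
    (t : BrieskornGroup p q r b b₁ b₂ b₃) : f hG * f t = f t * f hG :=
  commute_of_commute f (by simp only [← map_mul, h_mul_x]) (by simp only [← map_mul, h_mul_y])
    rfl t

/-- The images of `x` and `y` under an irreducible representation do not commute. -/
theorem map_x_mul_map_y_ne {α : BrieskornGroup p q r b b₁ b₂ b₃ →* Sp1} (hα : IsIrrep α) :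
    α xG * α yG ≠ α yG * α xG := by
  intro hxy
  obtain ⟨s, t, hst⟩ := hα
  have hx := commute_of_commute α rfl hxy (map_h_commute α xG).symm
  have hy := commute_of_commute α hxy.symm rfl (map_h_commute α yG).symm
  exact hst (commute_of_commute α (hx s).symm (hy s).symm (map_h_commute α s).symm t)

end BrieskornGroup

/-- (Lemma 2 of the paper.) For every irreducible `α : G(p,q,r) → Sp(1)`
there is `ρ ∈ Sp(1)` with `ρ² = -1` and `α∘σ = ρ·α·ρ⁻¹`; such `ρ` is unique up to sign.
In particular `α` is conjugate to `α∘σ`, i.e. the induced involution on conjugacy classes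
of irreducible representations is trivial. -/
theorem stmt_4 (p q r : ℕ) (hp : 2 ≤ p) (hq : 2 ≤ q) (hr : 2 ≤ r)
    (hpq : Nat.Coprime p q) (hqr : Nat.Coprime q r) (hpr : Nat.Coprime p r)
    (b b₁ b₂ b₃ : ℤ)
    (hsum : b₁ * q * r + b₂ * p * r + b₃ * p * q + b * p * q * r = 1)
    (σ : BrieskornGroup p q r b b₁ b₂ b₃ →* BrieskornGroup p q r b b₁ b₂ b₃)
    (hσ : SigmaSpec σ)
    (α : BrieskornGroup p q r b b₁ b₂ b₃ →* Sp1) (hα : IsIrrep α) :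
    (∃ ρ : Sp1, ρ ^ 2 = -1 ∧ (∀ t, α (σ t) = ρ * α t * ρ⁻¹) ∧
      ∀ ρ' : Sp1, (∀ t, α (σ t) = ρ' * α t * ρ'⁻¹) → ρ' = ρ ∨ ρ' = -ρ) ∧
    ∃ c : Sp1, ∀ t, α (σ t) = c * α t * c⁻¹ := by
  have hXY := BrieskornGroup.map_x_mul_map_y_ne hα
  obtain ⟨hσh, hσx, hσy, -⟩ := hσ
  obtain ⟨hHinv, hHcomm⟩ : (α hG)⁻¹ = α hG ∧ ∀ c, α hG * c = c * α hG := by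
    rcases Sp1.eq_one_or_neg_one_of_commute hXY (BrieskornGroup.map_h_commute α xG)
      (BrieskornGroup.map_h_commute α yG) with h | h
    · simp [h]
    · rw [h]
      exact ⟨Sp1.inv_neg_one, fun c => (Sp1.neg_one_mul c).trans (Sp1.mul_neg_one c).symm⟩
  obtain ⟨w, hw, hwX, hwY⟩ := Sp1.exists_conj_eq_inv hXY
  have hρ : ∀ t, α (σ t) = (α xG * w) * α t * (α xG * w)⁻¹ := by
    have h : α.comp σ = (MulAut.conj (α xG * w)).toMonoidHom.comp α := by
      refine BrieskornGroup.hom_ext ?_ ?_ ?_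
      · change α (σ xG) = α xG * w * α xG * (α xG * w)⁻¹
        rw [hσx, map_inv, mul_assoc (α xG) w, hwX]
        group
      · change α (σ yG) = α xG * w * α yG * (α xG * w)⁻¹
        rw [hσy, mul_assoc (α xG) w, hwY, map_mul, map_mul, map_inv, map_inv]
        group
      · change α (σ hG) = α xG * w * α hG * (α xG * w)⁻¹
        rw [hσh, map_inv, hHinv, ← hHcomm, mul_inv_cancel_right]
    exact DFunLike.congr_fun h
  refine ⟨⟨α xG * w, ?_, hρ, fun ρ' hρ' => ?_⟩, α xG * w, hρ⟩
  · rw [sq, mul_assoc, ← mul_assoc w, hwX, mul_assoc, mul_inv_cancel_left, ← sq, hw]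
  · have hcomm : ∀ t, ((α xG * w)⁻¹ * ρ') * α t = α t * ((α xG * w)⁻¹ * ρ') := by
      intro t
      have h := (hρ t).symm.trans (hρ' t)
      rw [eq_mul_inv_iff_mul_eq] at h
      rw [mul_assoc, ← h]
      group
    refine (Sp1.eq_one_or_neg_one_of_commute hXY (hcomm _) (hcomm _)).imp (fun h => ?_) fun h => ?_
    · exact (inv_mul_eq_one.mp h).symm
    · rw [inv_mul_eq_iff_eq_mul] at h
      rw [h, Sp1.mul_neg_one]
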